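/- If a node v has a pair of indistinguishable neighbours of order k in round 2t, then v has at least t+k−1 neighbours. Consequently, in round 2Δ no node of G has a pair of indistinguishable neighbours; that is, m_{2Δ}(u,v)≠m_{2Δ}(w,v) whenever u and w are two distinct neighbours of v in G. -/

import Mathlib

namespace Weak

/-- The degree of a vertex. -/
noncomputable def deg {n : ℕ} (G : SimpleGraph (Fin n)) (v : Fin n) : ℕ :=
  Nat.card {u : Fin n // G.Adj v u}

/-- A port of a graph: a pair (v, i) with i ∈ [deg v]. -/
abbrev Port {n : ℕ} (G : SimpleGraph (Fin n)) : Type := Σ v : Fin n, Fin (deg G v)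

/-- A port numbering: a bijection on ports with A(p) = A(G). -/
structure PortNumbering {n : ℕ} (G : SimpleGraph (Fin n)) where
  p : Port G ≃ Port G
  adj : ∀ u v : Fin n, (∃ i : Fin (deg G u), (p ⟨u, i⟩).1 = v) ↔ G.Adj u v

/-- A consistent port numbering is an involution. -/
def PortNumbering.Consistent {n : ℕ} {G : SimpleGraph (Fin n)} (pn : PortNumbering G) : Prop :=
  ∀ q : Port G, pn.p (pn.p q) = q

/-- A distributed state machine for F(Δ), with stopping states Y. -/
structure DSM (Y : Type) (Δ : ℕ) where
  Z : Type
  z₀ : Fin (Δ + 1) → Y ⊕ Z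
  M : Type
  m₀ : M
  μ : Z → Fin Δ → M
  δ : Z → (Fin Δ → M) → Y ⊕ Z

namespace DSM

variable {Y : Type} {Δ : ℕ}

/-- μ extended to stopping states: a stopped node sends the dummy message. -/
def μ' (A : DSM Y Δ) : Y ⊕ A.Z → Fin Δ → A.M
  | Sum.inl _ => fun _ => A.m₀
  | Sum.inr z => A.μ z

/-- δ extended to stopping states: a stopped node no longer changes state. -/
def δ' (A : DSM Y Δ) : Y ⊕ A.Z → (Fin Δ → A.M) → Y ⊕ A.Z
  | Sum.inl y, _ => Sum.inl y
  | Sum.inr z, m => A.δ z m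

/-- Machines whose transition depends only on the multiset of received messages. -/
def InMultiset (A : DSM Y Δ) : Prop :=
  ∀ (z : A.Z) (a b : Fin Δ → A.M),
    (List.ofFn a : Multiset A.M) = (List.ofFn b : Multiset A.M) → A.δ z a = A.δ z b

/-- Machines whose transition depends only on the set of received messages. -/
def InSet (A : DSM Y Δ) : Prop :=
  ∀ (z : A.Z) (a b : Fin Δ → A.M), Set.range a = Set.range b → A.δ z a = A.δ z b

/-- Machines that send the same message to all ports. -/
def InBroadcast (A : DSM Y Δ) : Prop :=
  ∀ (z : A.Z) (i j : Fin Δ), A.μ z i = A.μ z j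

end DSM

/-- The execution of a machine in (G, p): the state of node u at time t. -/
noncomputable def exec {Y : Type} {Δ n : ℕ} (A : DSM Y Δ) (G : SimpleGraph (Fin n))
    (hG : ∀ v, deg G v ≤ Δ) (pn : PortNumbering G) : ℕ → Fin n → Y ⊕ A.Z
  | 0, u => A.z₀ ⟨deg G u, Nat.lt_succ_of_le (hG u)⟩
  | t + 1, u =>
      A.δ' (exec A G hG pn t u) fun k =>
        if h : (k : ℕ) < deg G u then
          A.μ' (exec A G hG pn t (pn.p.symm ⟨u, ⟨(k : ℕ), h⟩⟩).1)
            ⟨((pn.p.symm ⟨u, ⟨(k : ℕ), h⟩⟩).2 : ℕ),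
              lt_of_lt_of_le (pn.p.symm ⟨u, ⟨(k : ℕ), h⟩⟩).2.isLt (hG _)⟩
        else A.m₀

/-- A graph problem: for each graph, a set of admissible outputs. -/
abbrev GraphProblem (Y : Type) : Type :=
  ∀ n : ℕ, SimpleGraph (Fin n) → Set ((Fin n) → Y)

/-- A sequence of machines solves a problem in time T. -/
def SolvesInTime {Y : Type} (A : ∀ Δ : ℕ, DSM Y Δ) (P : GraphProblem Y)
    (T : ℕ → ℕ → ℕ) : Prop :=
  ∀ (Δ n : ℕ) (G : SimpleGraph (Fin n)) (hG : ∀ v, deg G v ≤ Δ) (pn : PortNumbering G),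
    ∃ S ∈ P n G, ∀ u, exec (A Δ) G hG pn (T Δ n) u = Sum.inl (S u)

/-- A sequence of machines solves a problem in time T assuming consistency. -/
def SolvesInTimeConsistent {Y : Type} (A : ∀ Δ : ℕ, DSM Y Δ) (P : GraphProblem Y)
    (T : ℕ → ℕ → ℕ) : Prop :=
  ∀ (Δ n : ℕ) (G : SimpleGraph (Fin n)) (hG : ∀ v, deg G v ≤ Δ) (pn : PortNumbering G),
    pn.Consistent →
    ∃ S ∈ P n G, ∀ u, exec (A Δ) G hG pn (T Δ n) u = Sum.inl (S u)

/-- Problem class VV. -/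
def VV {Y : Type} (P : GraphProblem Y) : Prop :=
  ∃ A : ∀ Δ : ℕ, DSM Y Δ, ∃ T, SolvesInTime A P T

/-- Problem class MV. -/
def MV {Y : Type} (P : GraphProblem Y) : Prop :=
  ∃ A : ∀ Δ : ℕ, DSM Y Δ, (∀ Δ, (A Δ).InMultiset) ∧ ∃ T, SolvesInTime A P T

/-- Problem class SV. -/
def SV {Y : Type} (P : GraphProblem Y) : Prop :=
  ∃ A : ∀ Δ : ℕ, DSM Y Δ, (∀ Δ, (A Δ).InSet) ∧ ∃ T, SolvesInTime A P T

/-- Problem class VB. -/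
def VB {Y : Type} (P : GraphProblem Y) : Prop :=
  ∃ A : ∀ Δ : ℕ, DSM Y Δ, (∀ Δ, (A Δ).InBroadcast) ∧ ∃ T, SolvesInTime A P T

/-- Problem class MB. -/
def MB {Y : Type} (P : GraphProblem Y) : Prop :=
  ∃ A : ∀ Δ : ℕ, DSM Y Δ, (∀ Δ, (A Δ).InMultiset ∧ (A Δ).InBroadcast) ∧ ∃ T, SolvesInTime A P T

/-- Problem class SB. -/
def SB {Y : Type} (P : GraphProblem Y) : Prop :=
  ∃ A : ∀ Δ : ℕ, DSM Y Δ, (∀ Δ, (A Δ).InSet ∧ (A Δ).InBroadcast) ∧ ∃ T, SolvesInTime A P T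

/-- Problem class VVc. -/
def VVc {Y : Type} (P : GraphProblem Y) : Prop :=
  ∃ A : ∀ Δ : ℕ, DSM Y Δ, ∃ T, SolvesInTimeConsistent A P T

/-- Constant-time problem class VV(1). -/
def VV1 {Y : Type} (P : GraphProblem Y) : Prop :=
  ∃ A : ∀ Δ : ℕ, DSM Y Δ, ∃ T' : ℕ → ℕ, SolvesInTime A P fun Δ _ => T' Δ

/-- Constant-time problem class MV(1). -/
def MV1 {Y : Type} (P : GraphProblem Y) : Prop :=
  ∃ A : ∀ Δ : ℕ, DSM Y Δ, (∀ Δ, (A Δ).InMultiset) ∧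
    ∃ T' : ℕ → ℕ, SolvesInTime A P fun Δ _ => T' Δ

/-- Constant-time problem class SV(1). -/
def SV1 {Y : Type} (P : GraphProblem Y) : Prop :=
  ∃ A : ∀ Δ : ℕ, DSM Y Δ, (∀ Δ, (A Δ).InSet) ∧
    ∃ T' : ℕ → ℕ, SolvesInTime A P fun Δ _ => T' Δ

/-- Constant-time problem class VB(1). -/
def VB1 {Y : Type} (P : GraphProblem Y) : Prop :=
  ∃ A : ∀ Δ : ℕ, DSM Y Δ, (∀ Δ, (A Δ).InBroadcast) ∧
    ∃ T' : ℕ → ℕ, SolvesInTime A P fun Δ _ => T' Δ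

/-- Constant-time problem class MB(1). -/
def MB1 {Y : Type} (P : GraphProblem Y) : Prop :=
  ∃ A : ∀ Δ : ℕ, DSM Y Δ, (∀ Δ, (A Δ).InMultiset ∧ (A Δ).InBroadcast) ∧
    ∃ T' : ℕ → ℕ, SolvesInTime A P fun Δ _ => T' Δ

/-- Constant-time problem class SB(1). -/
def SB1 {Y : Type} (P : GraphProblem Y) : Prop :=
  ∃ A : ∀ Δ : ℕ, DSM Y Δ, (∀ Δ, (A Δ).InSet ∧ (A Δ).InBroadcast) ∧
    ∃ T' : ℕ → ℕ, SolvesInTime A P fun Δ _ => T' Δ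

/-- Constant-time problem class VVc(1). -/
def VVc1 {Y : Type} (P : GraphProblem Y) : Prop :=
  ∃ A : ∀ Δ : ℕ, DSM Y Δ, ∃ T' : ℕ → ℕ, SolvesInTimeConsistent A P fun Δ _ => T' Δ

end Weak
namespace Weak

/-- The type of the history values β_t. -/
def BetaType : ℕ → Type
  | 0 => Unit
  | t + 1 => BetaType t × Set (BetaType t × ℕ × ℕ)

/-- The outgoing port number at u that is connected to v. -/
noncomputable def portTo {n : ℕ} {G : SimpleGraph (Fin n)} (pn : PortNumbering G)
    (u v : Fin n) : ℕ :=
  sInf { i : ℕ | ∃ h : i < deg G u, (pn.p ⟨u, ⟨i, h⟩⟩).1 = v }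

/-- The pair (β_t, B_t): β_t(v) is the local history of v, and B_t(v) is the set of
messages (β_t(u), deg(u), π(u,v)) received by v in round t. -/
noncomputable def betaB {n : ℕ} (G : SimpleGraph (Fin n)) (pn : PortNumbering G) :
    ∀ t : ℕ, (Fin n → BetaType t) × (Fin n → Set (BetaType t × ℕ × ℕ))
  | 0 => (fun _ => (), fun _ => ∅)
  | t + 1 =>
      let prev := betaB G pn t
      let β : Fin n → BetaType (t + 1) := fun v => (prev.1 v, prev.2 v)
      (β, fun v => { m | ∃ u, G.Adj v u ∧ m = (β u, deg G u, portTo pn u v) })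

/-- β_t(v). -/
noncomputable def beta {n : ℕ} (G : SimpleGraph (Fin n)) (pn : PortNumbering G)
    (t : ℕ) (v : Fin n) : BetaType t :=
  (betaB G pn t).1 v

/-- u and w are a pair of indistinguishable neighbours of v in round t. -/
def IndistPair {n : ℕ} (G : SimpleGraph (Fin n)) (pn : PortNumbering G)
    (t : ℕ) (v u w : Fin n) : Prop :=
  u ≠ w ∧ G.Adj v u ∧ G.Adj v w ∧
    beta G pn t u = beta G pn t w ∧ deg G u = deg G w ∧ portTo pn u v = portTo pn w v

/-- u and w are a pair of indistinguishable neighbours of v of order k in round t. -/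
def IndistPairOrder {n : ℕ} (G : SimpleGraph (Fin n)) (pn : PortNumbering G)
    (t k : ℕ) (v u w : Fin n) : Prop :=
  IndistPair G pn t v u w ∧
    ∃ s : Finset (Fin n), s.card = k ∧ ∀ x ∈ s, G.Adj v x ∧ beta G pn t u = beta G pn t x

end Weak
namespace Weak

section IndistinguishableNeighbours

variable {n : ℕ} {G : SimpleGraph (Fin n)} (pn : PortNumbering G)

/-- The neighbours of `v` that have the same history as `u` in round `t`. -/
def twins (t : ℕ) (v u : Fin n) : Set (Fin n) :=
  {x | G.Adj v x ∧ beta G pn t u = beta G pn t x}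

theorem exists_port_eq_portTo {u v : Fin n} (h : G.Adj u v) :
    ∃ hi : portTo pn u v < deg G u, (pn.p ⟨u, ⟨portTo pn u v, hi⟩⟩).1 = v := by
  obtain ⟨i, hi⟩ := (pn.adj u v).2 h
  exact Nat.sInf_mem (s := {i : ℕ | ∃ h : i < deg G u, (pn.p ⟨u, ⟨i, h⟩⟩).1 = v})
    ⟨i, i.isLt, hi⟩

theorem eq_of_portTo_eq {v x y : Fin n} (hx : G.Adj v x) (hy : G.Adj v y)
    (h : portTo pn v x = portTo pn v y) : x = y := by
  obtain ⟨hi, hxi⟩ := exists_port_eq_portTo pn hx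
  obtain ⟨hj, hyj⟩ := exists_port_eq_portTo pn hy
  rw [← hxi, ← hyj]
  congr 4

theorem beta_eq_of_beta_succ_eq {t : ℕ} {a b : Fin n}
    (h : beta G pn (t + 1) a = beta G pn (t + 1) b) : beta G pn t a = beta G pn t b :=
  congrArg Prod.fst h

/-- Nodes with equal histories received the same messages in the previous round. -/
theorem exists_adj_of_beta_eq {t : ℕ} {a b c : Fin n}
    (h : beta G pn (t + 2) a = beta G pn (t + 2) b) (hac : G.Adj a c) :
    ∃ d, G.Adj b d ∧ beta G pn (t + 1) c = beta G pn (t + 1) d ∧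
      portTo pn c a = portTo pn d b := by
  have hB : (betaB G pn (t + 1)).2 a = (betaB G pn (t + 1)).2 b := congrArg Prod.snd h
  have hmem : (beta G pn (t + 1) c, deg G c, portTo pn c a) ∈ (betaB G pn (t + 1)).2 a :=
    ⟨c, hac, rfl⟩
  rw [hB] at hmem
  obtain ⟨d, hd, he⟩ := hmem
  exact ⟨d, hd, congrArg Prod.fst he, congrArg (fun m => m.2.2) he⟩

theorem ncard_twins_le_deg (t : ℕ) (v u : Fin n) : (twins pn t v u).ncard ≤ deg G v :=
  Set.ncard_le_ncard (t := {x | G.Adj v x}) (fun _ hx => hx.1) (Set.toFinite _)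

/-- Going back two rounds, an indistinguishable pair gains at least one twin. -/
theorem ncard_twins_lt {t : ℕ} {v u w : Fin n} (h : IndistPair G pn (t + 3) v u w) :
    (twins pn (t + 3) v u).ncard < (twins pn (t + 1) v u).ncard := by
  obtain ⟨huw, hu, hw, hβ, -, hport⟩ := h
  have hz : ∀ x ∈ twins pn (t + 3) v u, ∃ z y, G.Adj u y ∧ portTo pn v x = portTo pn y u ∧
      z ∈ twins pn (t + 1) v u ∧ portTo pn u y = portTo pn z v := by
    rintro x ⟨hvx, hx⟩
    obtain ⟨y, huy, hvy, hxy⟩ := exists_adj_of_beta_eq pn hx.symm hvx.symm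
    obtain ⟨z, hvz, huz, hyz⟩ := exists_adj_of_beta_eq pn hvy.symm huy.symm
    exact ⟨z, y, huy, hxy, ⟨hvz, huz⟩, hyz⟩
  choose! z y huy hxy hzmem hyz using hz
  have hinj : ∀ x ∈ twins pn (t + 3) v u, ∀ x' ∈ twins pn (t + 3) v u,
      portTo pn (z x) v = portTo pn (z x') v → x = x' := by
    intro x hx x' hx' he
    rw [← hyz x hx, ← hyz x' hx'] at he
    have hy := eq_of_portTo_eq pn (huy x hx) (huy x' hx') he
    refine eq_of_portTo_eq pn hx.1 hx'.1 ?_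
    rw [hxy x hx, hxy x' hx', hy]
  have hinjOn : Set.InjOn z (twins pn (t + 3) v u) := fun x hx x' hx' he =>
    hinj x hx x' hx' (by rw [he])
  rw [← hinjOn.ncard_image]
  refine Set.ncard_lt_ncard ?_ (Set.toFinite _)
  refine (Set.ssubset_iff_of_subset (Set.mapsTo_iff_image_subset.1 fun x hx => hzmem x hx)).2 ?_
  by_contra! hall
  obtain ⟨x, hx, hxu⟩ := hall u ⟨hu, rfl⟩
  obtain ⟨x', hx', hxw⟩ := hall w
    ⟨hw, beta_eq_of_beta_succ_eq pn (beta_eq_of_beta_succ_eq pn hβ)⟩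
  have hxx' := hinj x hx x' hx' (by rw [hxu, hxw, hport])
  exact huw (by rw [← hxu, ← hxw, hxx'])

theorem add_ncard_twins_le {v u w : Fin n} :
    ∀ t : ℕ, IndistPair G pn (2 * t) v u w → t + (twins pn (2 * t) v u).ncard ≤ deg G v + 1
  | 0, _ => by
    have := ncard_twins_le_deg pn (2 * 0) v u
    omega
  | 1, _ => by
    have := ncard_twins_le_deg pn (2 * 1) v u
    omega
  | t + 2, h => by
    have hlt : (twins pn (2 * (t + 2)) v u).ncard < (twins pn (2 * (t + 1)) v u).ncard :=
      ncard_twins_lt pn (t := 2 * t + 1) h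
    obtain ⟨huw, hu, hw, hβ, hdeg, hport⟩ := h
    have := add_ncard_twins_le (v := v) (u := u) (w := w) (t + 1)
      ⟨huw, hu, hw, beta_eq_of_beta_succ_eq pn (beta_eq_of_beta_succ_eq pn hβ), hdeg, hport⟩
    omega

end IndistinguishableNeighbours

/-- Lemma: an indistinguishable pair of order k in round 2t forces degree ≥ t + k − 1;
consequently in round 2Δ all messages received by a node are distinct. -/
theorem indist_pair_degree_bound {Δ n : ℕ} (G : SimpleGraph (Fin n))
    (hG : ∀ v, deg G v ≤ Δ) (pn : PortNumbering G) :
    (∀ (t k : ℕ) (v u w : Fin n),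
        IndistPairOrder G pn (2 * t) k v u w → t + k - 1 ≤ deg G v) ∧
    (∀ v u w : Fin n, u ≠ w → G.Adj v u → G.Adj v w →
        (beta G pn (2 * Δ) u, deg G u, portTo pn u v) ≠
        (beta G pn (2 * Δ) w, deg G w, portTo pn w v)) := by
  have bound : ∀ (t k : ℕ) (v u w : Fin n),
      IndistPairOrder G pn (2 * t) k v u w → t + k - 1 ≤ deg G v := by
    rintro t k v u w ⟨hpair, s, rfl, hs⟩
    have hle : s.card ≤ (twins pn (2 * t) v u).ncard := by
      rw [← Set.ncard_coe_finset s]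
      exact Set.ncard_le_ncard hs (Set.toFinite _)
    have := add_ncard_twins_le pn t hpair
    omega
  refine ⟨bound, fun v u w huw hu hw he => ?_⟩
  obtain ⟨hβ, hdeg, hport⟩ : beta G pn (2 * Δ) u = beta G pn (2 * Δ) w ∧ deg G u = deg G w ∧
      portTo pn u v = portTo pn w v := by simpa only [Prod.mk.injEq] using he
  have := bound Δ 2 v u w ⟨⟨huw, hu, hw, hβ, hdeg, hport⟩, {u, w}, Finset.card_pair huw, by
    simp [hu, hw, hβ]⟩
  have := hG v
  omega

end Weak
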